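/- For n ≥ 6, |R(Hₙ)| - |R(H_{n-1})| = n² - n, where R(H_{n-1}) is identified with the subsystem of R(Hₙ) supported on E₀,…,E_{n-2}. -/

import Mathlib

open Finset

def HAdj (i j : ℕ) : Bool :=
  decide ((i = 0 ∧ j = 3) ∨ (j = 0 ∧ i = 3) ∨ (1 ≤ i ∧ i + 1 = j) ∨ (1 ≤ j ∧ j + 1 = i))

def HM (i j : ℕ) : ℤ :=
  if i = j then (if i = 0 then -3 else -2) else if HAdj i j then 1 else 0

def HQ (n : ℕ) (Y : ℕ → ℤ) : ℤ :=
  ∑ i ∈ Finset.range n, ∑ j ∈ Finset.range n, Y i * HM i j * Y j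

/-- The triple root system of `Hₙ` (vertices `E₀,…,E_{n-1}`, chain `E₁—⋯—E_{n-1}`,
weight-3 vertex `E₀` attached to `E₃`). -/
def HRoots (n : ℕ) : Set (ℕ → ℤ) :=
  {Y : ℕ → ℤ | (∀ i, n ≤ i → Y i = 0) ∧ Y ≠ 0 ∧
    ((∀ i, 0 ≤ Y i) ∨ (∀ i, Y i ≤ 0)) ∧ (HQ n Y = -2 ∨ HQ n Y = -3)}

/-- Orthogonal coordinates: `E_i = e_i - e_{i+1}`, `E_0 = -(e_1+e_2+e_3)` (indices shifted). -/
def dv (Y : ℕ → ℤ) (k : ℕ) : ℤ :=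
  Y (k + 1) - (if k = 0 then 0 else Y k) - (if k < 3 then Y 0 else 0)

lemma dv_key (Y : ℕ → ℤ) (k : ℕ) :
    Y (k + 1) = Y 0 * (min (k + 1) 3 : ℕ) + ∑ j ∈ range (k + 1), dv Y j := by
  induction k with
  | zero => simp [dv]
  | succ k ih =>
    rw [Finset.sum_range_succ]
    have e : dv Y (k + 1) = Y (k + 2) - Y (k + 1) - (if k + 1 < 3 then Y 0 else 0) := by
      simp [dv]
    rw [e]
    by_cases h : k + 1 < 3
    · have h1 : min (k + 1 + 1) 3 = k + 2 := by omega
      have h2 : min (k + 1) 3 = k + 1 := by omega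
      rw [h1]; rw [h2] at ih
      rw [if_pos h]
      push_cast at *
      linarith
    · have h1 : min (k + 1 + 1) 3 = 3 := by omega
      have h2 : min (k + 1) 3 = 3 := by omega
      rw [h1]; rw [h2] at ih
      rw [if_neg h]
      push_cast at *
      linarith

lemma HM_symm (i j : ℕ) : HM i j = HM j i := by
  unfold HM HAdj
  by_cases h : i = j
  · subst h; rfl
  · have h' : ¬ j = i := fun e => h e.symm
    simp only [h, h', if_false]
    congr 1
    simp only [decide_eq_true_eq]
    apply propext
    omega

lemma cross (Y : ℕ → ℤ) (m : ℕ) (hm : 3 ≤ m) :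
    ∑ i ∈ range (m + 1), Y i * HM i (m + 1) * Y (m + 1) = Y m * Y (m + 1) := by
  rw [Finset.sum_eq_single m]
  · have : HM m (m + 1) = 1 := by
      unfold HM HAdj
      simp
      omega
    rw [this]; ring
  · intro i hi hne
    have hi' := Finset.mem_range.1 hi
    have : HM i (m + 1) = 0 := by
      unfold HM HAdj
      rw [if_neg (by omega), if_neg]
      simp only [decide_eq_true_eq]
      omega
    rw [this]; ring
  · intro h; simp at h

lemma HQ_succ (Y : ℕ → ℤ) (m : ℕ) (hm : 3 ≤ m) :
    HQ (m + 2) Y = HQ (m + 1) Y + 2 * (Y m * Y (m + 1)) - 2 * Y (m + 1) ^ 2 := by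
  unfold HQ
  rw [Finset.sum_range_succ]
  simp_rw [Finset.sum_range_succ _ (m + 1)]
  rw [Finset.sum_add_distrib, cross Y m hm]
  have h2 : ∑ j ∈ range (m + 1), Y (m + 1) * HM (m + 1) j * Y j = Y m * Y (m + 1) := by
    rw [← cross Y m hm]
    apply Finset.sum_congr rfl
    intro i _
    rw [HM_symm]; ring
  rw [h2]
  have : HM (m + 1) (m + 1) = -2 := by simp [HM]
  rw [this]; ring

lemma HQ_eq (Y : ℕ → ℤ) (m : ℕ) (hm : 3 ≤ m) :
    HQ (m + 1) Y = -(∑ k ∈ range m, dv Y k ^ 2 + Y m ^ 2) := by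
  induction m, hm using Nat.le_induction with
  | base =>
    simp [HQ, Finset.sum_range_succ, HM, HAdj, dv]
    ring
  | succ m hm ih =>
    rw [HQ_succ Y m hm, ih, Finset.sum_range_succ]
    have e : dv Y m = Y (m + 1) - Y m := by
      simp [dv, show m ≠ 0 by omega, show ¬ m < 3 by omega]
    rw [e]; ring

lemma dv_sum (Y : ℕ → ℤ) (m : ℕ) (hm : 3 ≤ m) :
    Y m = Y 0 * 3 + ∑ j ∈ range m, dv Y j := by
  obtain ⟨k, rfl⟩ : ∃ k, m = k + 1 := ⟨m - 1, by omega⟩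
  have := dv_key Y k
  rw [show min (k + 1) 3 = 3 by omega] at this
  exact_mod_cast this

lemma dv_inj (m : ℕ) (hm : 3 ≤ m) (Y Z : ℕ → ℤ) (hY : ∀ i, m + 1 ≤ i → Y i = 0)
    (hZ : ∀ i, m + 1 ≤ i → Z i = 0) (h : ∀ k, k < m → dv Y k = dv Z k) (hmm : Y m = Z m) :
    Y = Z := by
  have hs : ∀ r, r ≤ m → ∑ j ∈ range r, dv Y j = ∑ j ∈ range r, dv Z j := by
    intro r hr
    apply Finset.sum_congr rfl
    intro j hj
    exact h j (lt_of_lt_of_le (Finset.mem_range.1 hj) hr)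
  have h0 : Y 0 = Z 0 := by
    have a := dv_sum Y m hm
    have b := dv_sum Z m hm
    have := hs m le_rfl
    omega
  funext i
  rcases Nat.lt_or_ge m i with hi | hi
  · rw [hY i hi, hZ i hi]
  · rcases i with _ | k
    · exact h0
    · rw [dv_key Y k, dv_key Z k, hs _ hi, h0]

lemma HRoots_finite (m : ℕ) (hm : 3 ≤ m) : (HRoots (m + 1)).Finite := by
  let f : (ℕ → ℤ) → (Fin m → ℤ) × ℤ := fun Y => (fun k => dv Y k, Y m)
  have hfin : ((Fintype.piFinset (fun _ : Fin m => Finset.Icc (-3 : ℤ) 3) ×ˢ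
      Finset.Icc (-3 : ℤ) 3 : Finset ((Fin m → ℤ) × ℤ)) : Set ((Fin m → ℤ) × ℤ)).Finite :=
    Finset.finite_toSet _
  refine Set.Finite.of_injOn (f := f) ?_ ?_ hfin
  · rintro Y ⟨h0, hne, hs, hq⟩
    rw [HQ_eq Y m hm] at hq
    have hpos : 0 ≤ ∑ k ∈ range m, dv Y k ^ 2 := Finset.sum_nonneg (fun _ _ => sq_nonneg _)
    have aux : ∀ x : ℤ, x ^ 2 ≤ 3 → -3 ≤ x ∧ x ≤ 3 := by
      intro x hx; constructor <;> nlinarith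
    simp only [f, Finset.coe_product, Set.mem_prod, Finset.mem_coe, Fintype.mem_piFinset,
      Finset.mem_Icc]
    constructor
    · intro k
      apply aux
      have := Finset.single_le_sum (f := fun k => dv Y k ^ 2) (fun _ _ => sq_nonneg _)
        (Finset.mem_range.2 k.2)
      have := sq_nonneg (Y m)
      omega
    · apply aux
      omega
  · rintro Y ⟨hY, -⟩ Z ⟨hZ, -⟩ he
    simp only [f, Prod.mk.injEq] at he
    exact dv_inj m hm Y Z hY hZ (fun k hk => congrFun he.1 ⟨k, hk⟩) he.2

/-- Effective roots with nonzero last coordinate. -/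
def HP (m : ℕ) : Set (ℕ → ℤ) := {Y | Y ∈ HRoots (m + 1) ∧ 0 < Y m}

def supp (m : ℕ) (Y : ℕ → ℤ) : Finset ℕ := (range m).filter (fun k => dv Y k ≠ 0)

lemma HP_class (m : ℕ) (hm : 3 ≤ m) (Y : ℕ → ℤ) (hY : Y ∈ HP m) :
    Y m = 1 ∧ (((supp m Y).card = 1 ∧ ∀ k ∈ supp m Y, dv Y k = 1) ∨
      ((supp m Y).card = 2 ∧ ∀ k ∈ supp m Y, dv Y k = -1)) := by
  obtain ⟨⟨h0, hne, hs, hq⟩, hp⟩ := hY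
  rw [HQ_eq Y m hm] at hq
  have hpos : 0 ≤ ∑ k ∈ range m, dv Y k ^ 2 := Finset.sum_nonneg (fun _ _ => sq_nonneg _)
  have h1 : Y m = 1 := by
    have : Y m < 2 := by rcases hq with h | h <;> nlinarith
    omega
  refine ⟨h1, ?_⟩
  rw [h1] at hq
  have hsum := dv_sum Y m hm
  rw [h1] at hsum
  have hb : ∀ k ∈ supp m Y, dv Y k = 1 ∨ dv Y k = -1 := by
    intro k hk
    obtain ⟨hk1, hk2⟩ := Finset.mem_filter.1 hk
    have := Finset.single_le_sum (f := fun k => dv Y k ^ 2) (fun _ _ => sq_nonneg _) hk1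
    have h3 : dv Y k ^ 2 ≤ 2 := by omega
    have h4 : dv Y k < 2 := by nlinarith
    have h5 : -2 < dv Y k := by nlinarith
    omega
  have hf : ∑ k ∈ range m, dv Y k = ∑ k ∈ supp m Y, dv Y k := by
    unfold supp; rw [Finset.sum_filter_ne_zero]
  have hf2 : ∑ k ∈ range m, dv Y k ^ 2 = (supp m Y).card := by
    have : ∑ k ∈ supp m Y, dv Y k ^ 2 = ∑ k ∈ range m, dv Y k ^ 2 := by
      apply Finset.sum_subset (Finset.filter_subset _ _)
      intro k hk hk'
      have : dv Y k = 0 := by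
        by_contra h
        exact hk' (Finset.mem_filter.2 ⟨hk, h⟩)
      rw [this]; rfl
    rw [← this, Finset.sum_congr rfl (g := fun _ => (1 : ℤ))]
    · simp
    · intro k hk
      rcases hb k hk with h | h <;> rw [h] <;> rfl
  rw [hf] at hsum
  rw [hf2] at hq
  have hc : (supp m Y).card = 1 ∨ (supp m Y).card = 2 := by omega
  rcases hc with hc | hc
  · left
    refine ⟨hc, ?_⟩
    obtain ⟨a, ha⟩ := Finset.card_eq_one.1 hc
    rw [ha] at hb hsum ⊢
    simp at hb hsum ⊢
    omega
  · right
    refine ⟨hc, ?_⟩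
    obtain ⟨a, b, hab, ha⟩ := Finset.card_eq_two.1 hc
    rw [ha] at hb hsum ⊢
    rw [Finset.sum_pair hab] at hsum
    simp at hb ⊢
    omega

/-- Reconstruct a divisor from `dv` values and the `E_0` coefficient. -/
def mkY (m : ℕ) (c : ℤ) (v : ℕ → ℤ) (k : ℕ) : ℤ :=
  if k = 0 then c else if k ≤ m then c * (min k 3 : ℕ) + ∑ j ∈ range k, v j else 0

lemma dv_mkY (m : ℕ) (c : ℤ) (v : ℕ → ℤ) (k : ℕ) (hk : k < m) : dv (mkY m c v) k = v k := by
  unfold dv mkY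
  rcases k with _ | k
  · simp [show 1 ≤ m by omega]
  · rw [if_neg (by omega), if_pos (by omega), if_neg (by omega), if_neg (by omega),
      if_pos (by omega), if_pos rfl, Finset.sum_range_succ _ (k + 1)]
    by_cases h : k + 1 < 3
    · rw [if_pos h, show min (k + 1 + 1) 3 = k + 2 by omega, show min (k + 1) 3 = k + 1 by omega]
      push_cast; ring
    · rw [if_neg h, show min (k + 1 + 1) 3 = 3 by omega, show min (k + 1) 3 = 3 by omega]
      push_cast; ring

lemma mkY_mem (m : ℕ) (hm : 3 ≤ m) (c : ℤ) (v : ℕ → ℤ) (hc : 0 ≤ c)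
    (hsum : c * 3 + ∑ j ∈ range m, v j = 1)
    (hnn : ∀ k, 0 ≤ c * (min k 3 : ℕ) + ∑ j ∈ range k, v j)
    (hsq : ∑ j ∈ range m, v j ^ 2 = 1 ∨ ∑ j ∈ range m, v j ^ 2 = 2) :
    mkY m c v ∈ HP m := by
  have hmm : mkY m c v m = 1 := by
    unfold mkY
    rw [if_neg (by omega), if_pos le_rfl, show min m 3 = 3 by omega]
    exact_mod_cast hsum
  refine ⟨⟨?_, ?_, ?_, ?_⟩, ?_⟩
  · intro i hi
    unfold mkY
    rw [if_neg (by omega), if_neg (by omega)]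
  · intro h
    rw [h] at hmm
    simp at hmm
  · left
    intro i
    unfold mkY
    split_ifs
    · exact hc
    · exact hnn i
    · exact le_rfl
  · rw [HQ_eq _ m hm, hmm]
    have : ∑ k ∈ range m, dv (mkY m c v) k ^ 2 = ∑ k ∈ range m, v k ^ 2 :=
      Finset.sum_congr rfl (fun k hk => by rw [dv_mkY m c v k (Finset.mem_range.1 hk)])
    rw [this]
    omega
  · rw [hmm]; norm_num

lemma supp_mkY (m : ℕ) (c : ℤ) (v : ℕ → ℤ) :
    supp m (mkY m c v) = (range m).filter (fun k => v k ≠ 0) := by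
  apply Finset.filter_congr
  intro k hk
  rw [dv_mkY m c v k (Finset.mem_range.1 hk)]

lemma HP_ncard (m : ℕ) (hm : 3 ≤ m) : (HP m).ncard = m + m.choose 2 := by
  have hinj : Set.InjOn (supp m) (HP m) := by
    intro Y hY Z hZ he
    have a := HP_class m hm Y hY
    have b := HP_class m hm Z hZ
    refine dv_inj m hm Y Z hY.1.1 hZ.1.1 ?_ (a.1.trans b.1.symm)
    intro k hk
    rw [← he] at b
    by_cases hkm : k ∈ supp m Y
    · rcases a.2 with ⟨a1, a2⟩ | ⟨a1, a2⟩ <;> rcases b.2 with ⟨b1, b2⟩ | ⟨b1, b2⟩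
      · rw [a2 k hkm, b2 k hkm]
      · omega
      · omega
      · rw [a2 k hkm, b2 k hkm]
    · have h2 : k ∉ supp m Z := he ▸ hkm
      simp only [supp, Finset.mem_filter, Finset.mem_range, not_and, not_not] at hkm h2
      rw [hkm hk, h2 hk]
  have himg : supp m '' HP m =
      ((powersetCard 1 (range m) ∪ powersetCard 2 (range m) : Finset (Finset ℕ)) :
        Set (Finset ℕ)) := by
    ext S
    simp only [Set.mem_image, Finset.coe_union, Set.mem_union, Finset.mem_coe,
      Finset.mem_powersetCard]
    constructor
    · rintro ⟨Y, hY, rfl⟩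
      have hsub : supp m Y ⊆ range m := Finset.filter_subset _ _
      rcases (HP_class m hm Y hY).2 with ⟨a1, -⟩ | ⟨a1, -⟩
      · exact Or.inl ⟨hsub, a1⟩
      · exact Or.inr ⟨hsub, a1⟩
    · have hgen : ∀ ε : ℤ, ε ≠ 0 → S ⊆ range m →
          (range m).filter (fun k => (if k ∈ S then ε else 0) ≠ 0) = S := by
        intro ε hε hS
        ext k
        have := @hS k
        by_cases hk : k ∈ S <;> simp_all
      have hsumk : ∀ (ε : ℤ) (k : ℕ), ∑ j ∈ range k, (if j ∈ S then ε else 0)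
          = ε * ((range k ∩ S).card : ℤ) := by
        intro ε k
        rw [Finset.sum_ite_mem, Finset.sum_const, nsmul_eq_mul, mul_comm]
      have hsq : ∀ ε : ℤ, ∑ j ∈ range m, (if j ∈ S then ε else 0) ^ 2
          = ε ^ 2 * ((range m ∩ S).card : ℤ) := by
        intro ε
        rw [← nsmul_eq_mul', ← Finset.sum_const, ← Finset.sum_ite_mem]
        apply Finset.sum_congr rfl
        intro j _
        split_ifs <;> simp
      rintro (⟨hS, hc⟩ | ⟨hS, hc⟩)
      · have hi : range m ∩ S = S := Finset.inter_eq_right.2 hS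
        refine ⟨mkY m 0 (fun k => if k ∈ S then 1 else 0), mkY_mem m hm _ _ le_rfl ?_ ?_ ?_, ?_⟩
        · rw [hsumk, hi, hc]; norm_num
        · intro k; rw [hsumk]; positivity
        · rw [hsq, hi, hc]; norm_num
        · rw [supp_mkY]; exact hgen 1 (by norm_num) hS
      · have hi : range m ∩ S = S := Finset.inter_eq_right.2 hS
        refine ⟨mkY m 1 (fun k => if k ∈ S then -1 else 0),
          mkY_mem m hm _ _ zero_le_one ?_ ?_ ?_, ?_⟩
        · rw [hsumk, hi, hc]; norm_num
        · intro k; rw [hsumk]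
          have h1 : (range k ∩ S).card ≤ k := by
            simpa using Finset.card_le_card (Finset.inter_subset_left (s₁ := range k) (s₂ := S))
          have h2 : (range k ∩ S).card ≤ 2 := by
            rw [← hc]; exact Finset.card_le_card Finset.inter_subset_right
          omega
        · rw [hsq, hi, hc]; norm_num
        · rw [supp_mkY]; exact hgen (-1) (by norm_num) hS
  rw [← Set.ncard_image_of_injOn hinj, himg, Set.ncard_coe_finset,
    Finset.card_union_of_disjoint, Finset.card_powersetCard, Finset.card_powersetCard]
  · simp
  · rw [Finset.disjoint_left]
    intro S h1 h2
    rw [Finset.mem_powersetCard] at h1 h2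
    omega

lemma HQ_neg (n : ℕ) (Y : ℕ → ℤ) : HQ n (-Y) = HQ n Y := by
  unfold HQ
  apply Finset.sum_congr rfl; intro i _
  apply Finset.sum_congr rfl; intro j _
  simp

lemma HRoots_neg (n : ℕ) (Y : ℕ → ℤ) (h : Y ∈ HRoots n) : -Y ∈ HRoots n := by
  obtain ⟨h0, hne, hs, hq⟩ := h
  refine ⟨fun i hi => by simp [h0 i hi], by simpa using hne, ?_, by rwa [HQ_neg]⟩
  rcases hs with h | h
  · right; intro i; simpa using h i
  · left; intro i; simpa using h i

theorem stmt_12 (n : ℕ) (hn : 6 ≤ n) :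
    (HRoots n).ncard - {Y ∈ HRoots n | Y (n - 1) = 0}.ncard = n ^ 2 - n := by
  obtain ⟨m, rfl⟩ : ∃ m, n = m + 1 := ⟨n - 1, by omega⟩
  have hm : 3 ≤ m := by omega
  rw [Nat.add_sub_cancel]
  have hfin := HRoots_finite m hm
  have hPfin : (HP m).Finite := hfin.subset (fun Y h => h.1)
  have hsub : {Y ∈ HRoots (m + 1) | Y m = 0} ⊆ HRoots (m + 1) := fun Y h => h.1
  rw [← Set.ncard_sdiff hsub (hfin.subset hsub)]
  have hD : HRoots (m + 1) \ {Y ∈ HRoots (m + 1) | Y m = 0} =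
      HP m ∪ (fun Y => -Y) '' HP m := by
    ext Y
    constructor
    · rintro ⟨h1, h2⟩
      have h3 : Y m ≠ 0 := fun h => h2 ⟨h1, h⟩
      rcases lt_or_gt_of_ne h3 with h | h
      · right
        exact ⟨-Y, ⟨HRoots_neg _ _ h1, by simpa using h⟩, neg_neg Y⟩
      · exact Or.inl ⟨h1, h⟩
    · rintro (h | ⟨Z, h, rfl⟩)
      · exact ⟨h.1, fun h' => h.2.ne' h'.2⟩
      · refine ⟨HRoots_neg _ _ h.1, fun h' => h.2.ne' ?_⟩
        simpa using h'.2
  rw [hD, Set.ncard_union_eq _ hPfin (hPfin.image _),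
    Set.ncard_image_of_injective _ neg_injective, HP_ncard m hm]
  · have h2 := Nat.choose_two_right m
    have h3 := Nat.even_mul_pred_self m
    have h4 : 2 * m.choose 2 = m * (m - 1) := by
      rw [h2]; exact Nat.mul_div_cancel' h3.two_dvd
    obtain ⟨k, rfl⟩ : ∃ k, m = k + 1 := ⟨m - 1, by omega⟩
    rw [Nat.add_sub_cancel] at h4
    have h5 : (k + 1 + 1) ^ 2 = (k + 1) * k + 2 * (k + 1) + (k + 1 + 1) := by ring
    omega
  · rw [Set.disjoint_left]
    rintro Y h ⟨Z, hZ, rfl⟩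
    have a := h.2
    have b := hZ.2
    simp at a
    omega
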